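/- Unrestricted ∃-Elim: If (i) Γ ⊢ ∃vφ and (ii) Σ ∪ {φ(a_i)} ⊢ ψ, where the fresh constant a_i does not occur in Σ ∪ {φ, ψ}, then Γ ∪ Σ ⊢ ψ. -/

import Mathlib

universe u v

namespace BQL

structure Signature : Type 1 where
  Const : Type
  Func : Type
  arityF : Func → ℕ
  Rel : Type
  arityR : Rel → ℕ

inductive Term (L : Signature) : Type
  | var : ℕ → Term L
  | const : L.Const → Term L
  | func : (f : L.Func) → (Fin (L.arityF f) → Term L) → Term L

inductive Formula (L : Signature) : Type
  | top : Formula L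
  | bot : Formula L
  | rel : (R : L.Rel) → (Fin (L.arityR R) → Term L) → Formula L
  | and : Formula L → Formula L → Formula L
  | or : Formula L → Formula L → Formula L
  | imp : Formula L → Formula L → Formula L
  | all : Formula L → Formula L
  | ex : Formula L → Formula L

variable {L : Signature}

namespace Term

/-- Shift all (free) variables of a term up by one. -/
def shiftUp : Term L → Term L
  | var n => var (n + 1)
  | const c => const c
  | func f ts => func f fun i => (ts i).shiftUp

/-- Apply a simultaneous substitution to a term. -/
def applySub (σ : ℕ → Term L) : Term L → Term L
  | var n => σ n
  | const c => const c
  | func f ts => func f fun i => (ts i).applySub σ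

/-- All variables of the term are `< k`. -/
def ClosedAt : Term L → ℕ → Prop
  | var n, k => n < k
  | const _, _ => True
  | func _ ts, k => ∀ i, (ts i).ClosedAt k

/-- A closed term. -/
def Closed (t : Term L) : Prop := t.ClosedAt 0

/-- The constant `c` occurs in the term. -/
def OccC (c : L.Const) : Term L → Prop
  | var _ => False
  | const d => d = c
  | func _ ts => ∃ i, (ts i).OccC c

end Term

/-- Lift a substitution under a binder. -/
def liftSub (σ : ℕ → Term L) : ℕ → Term L
  | 0 => .var 0
  | n + 1 => (σ n).shiftUp

namespace Formula

/-- Apply a simultaneous substitution to a formula. -/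
def applySub (σ : ℕ → Term L) : Formula L → Formula L
  | top => top
  | bot => bot
  | rel R ts => rel R fun i => (ts i).applySub σ
  | and φ ψ => and (φ.applySub σ) (ψ.applySub σ)
  | or φ ψ => or (φ.applySub σ) (ψ.applySub σ)
  | imp φ ψ => imp (φ.applySub σ) (ψ.applySub σ)
  | all φ => all (φ.applySub (liftSub σ))
  | ex φ => ex (φ.applySub (liftSub σ))

/-- All free variables of the formula are `< k`. -/
def ClosedAt : Formula L → ℕ → Prop
  | top, _ => True
  | bot, _ => True
  | rel _ ts, k => ∀ i, (ts i).ClosedAt k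
  | and φ ψ, k => φ.ClosedAt k ∧ ψ.ClosedAt k
  | or φ ψ, k => φ.ClosedAt k ∧ ψ.ClosedAt k
  | imp φ ψ, k => φ.ClosedAt k ∧ ψ.ClosedAt k
  | all φ, k => φ.ClosedAt (k + 1)
  | ex φ, k => φ.ClosedAt (k + 1)

/-- A sentence: a formula with no free variables. -/
def Sentence (φ : Formula L) : Prop := φ.ClosedAt 0

/-- The constant `c` occurs in the formula. -/
def OccC (c : L.Const) : Formula L → Prop
  | top => False
  | bot => False
  | rel _ ts => ∃ i, (ts i).OccC c
  | and φ ψ => φ.OccC c ∨ ψ.OccC c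
  | or φ ψ => φ.OccC c ∨ ψ.OccC c
  | imp φ ψ => φ.OccC c ∨ ψ.OccC c
  | all φ => φ.OccC c
  | ex φ => φ.OccC c

/-- The formula contains no occurrence of `∨` and no occurrence of `∃`. -/
def NoOrEx : Formula L → Prop
  | top => True
  | bot => True
  | rel _ _ => True
  | and φ ψ => φ.NoOrEx ∧ ψ.NoOrEx
  | or _ _ => False
  | imp φ ψ => φ.NoOrEx ∧ ψ.NoOrEx
  | all φ => φ.NoOrEx
  | ex _ => False

end Formula

/-- Substitute the term `t` for the variable `v₀` (lowering the other variables). -/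
def subst0 (φ : Formula L) (t : Term L) : Formula L :=
  φ.applySub fun n => match n with | 0 => t | n + 1 => .var n

/-- `□ⁿφ`, where `□φ` abbreviates `⊤ → φ`. -/
def boxN : ℕ → Formula L → Formula L
  | 0, φ => φ
  | n + 1, φ => .imp .top (boxN n φ)

/-- The conjunction of a finite list of formulas (`⋀∅ = ⊤`). -/
def conjL : List (Formula L) → Formula L
  | [] => .top
  | [φ] => φ
  | φ :: ψ :: l => .and φ (conjL (ψ :: l))

/-- The language `L⁺`, obtained from `L` by adding countably many fresh constants `aᵢ`. -/
def Signature.plus (L : Signature) : Signature where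
  Const := L.Const ⊕ ℕ
  Func := L.Func
  arityF := L.arityF
  Rel := L.Rel
  arityR := L.arityR

/-- The fresh constant `aᵢ` of `L⁺`. -/
def aconst (L : Signature) (i : ℕ) : Term L.plus := .const (Sum.inr i)

/-- Embedding of `L`-terms into `L⁺`-terms. -/
def Term.emb : Term L → Term L.plus
  | .var n => .var n
  | .const c => .const (Sum.inl c)
  | .func f ts => .func f fun i => (ts i).emb

/-- Embedding of `L`-formulas into `L⁺`-formulas. -/
def Formula.emb : Formula L → Formula L.plus
  | .top => .top
  | .bot => .bot
  | .rel R ts => .rel R fun i => (ts i).emb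
  | .and φ ψ => .and φ.emb ψ.emb
  | .or φ ψ => .or φ.emb ψ.emb
  | .imp φ ψ => .imp φ.emb ψ.emb
  | .all φ => .all φ.emb
  | .ex φ => .ex φ.emb

/-- The fresh constant `aᵢ` occurs in no member of `Γ`. -/
def FreshIn (i : ℕ) (Γ : Set (Formula L.plus)) : Prop :=
  ∀ ψ ∈ Γ, ¬ ψ.OccC (Sum.inr i)

/-- A Kripke `L`-model (the frame conditions are packaged in `KModel.Proper`). -/
structure KModel (L : Signature) : Type (u + 1) where
  W : Type u
  acc : W → W → Prop
  D : Type u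
  interpC : L.Const → D
  interpF : (f : L.Func) → (Fin (L.arityF f) → D) → D
  interpR : (R : L.Rel) → W → Set (Fin (L.arityR R) → D)

/-- The conditions on an `L`-model: nonempty set of worlds, transitive accessibility
relation, nonempty domain, and the persistence constraint. -/
def KModel.Proper (M : KModel.{u} L) : Prop :=
  Nonempty M.W ∧ Nonempty M.D ∧ Transitive M.acc ∧
    ∀ (R : L.Rel) (w u' : M.W), M.acc w u' → M.interpR R w ⊆ M.interpR R u'

/-- Prepend a value to a valuation. -/
def vcons {α : Sort*} (d : α) (ρ : ℕ → α) : ℕ → α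
  | 0 => d
  | n + 1 => ρ n

/-- Denotation of a term. -/
def Term.eval (M : KModel.{u} L) (ρ : ℕ → M.D) : Term L → M.D
  | .var n => ρ n
  | .const c => M.interpC c
  | .func f ts => M.interpF f fun i => (ts i).eval M ρ

/-- The satisfaction relation `w ⊩ φ(ā)`. -/
def Sat (M : KModel.{u} L) : M.W → (ℕ → M.D) → Formula L → Prop
  | _, _, .top => True
  | _, _, .bot => False
  | w, ρ, .rel R ts => (fun i => (ts i).eval M ρ) ∈ M.interpR R w
  | w, ρ, .and φ ψ => Sat M w ρ φ ∧ Sat M w ρ ψ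
  | w, ρ, .or φ ψ => Sat M w ρ φ ∨ Sat M w ρ ψ
  | w, ρ, .imp φ ψ => ∀ u', M.acc w u' → Sat M u' ρ φ → Sat M u' ρ ψ
  | w, ρ, .all φ => ∀ d, Sat M w (vcons d ρ) φ
  | w, ρ, .ex φ => ∃ d, Sat M w (vcons d ρ) φ

/-- Satisfaction of a sentence (under every valuation). -/
def SatS (M : KModel.{u} L) (w : M.W) (φ : Formula L) : Prop := ∀ ρ, Sat M w ρ φ

/-- `Γ ⊨ φ`: truth is preserved at every reflexive world of every `L`-model. -/
def Models (Γ : Set (Formula L)) (φ : Formula L) : Prop :=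
  ∀ M : KModel.{u} L, M.Proper → ∀ w : M.W, M.acc w w →
    (∀ ψ ∈ Γ, SatS M w ψ) → SatS M w φ

/-- `Γ : Δ ⊨ φ`: for every `L`-model, every reflexive world `w` and every world `u ≻ w`:
if `w ⊩ Γ` and `u ⊩ Δ` then `u ⊩ φ`. -/
def ModelsCtx (Γ Δ : Set (Formula L)) (φ : Formula L) : Prop :=
  ∀ M : KModel.{u} L, M.Proper → ∀ w u' : M.W, M.acc w w → M.acc w u' →
    (∀ ψ ∈ Γ, SatS M w ψ) → (∀ ψ ∈ Δ, SatS M u' ψ) → SatS M u' φ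

end BQL

namespace BQL

/-- `Prf L Γ Δ φ` formalizes `Γ : Δ ⊢ φ`: there is a proof of `φ` in the natural
deduction system `NBQL_CD^r` (over `L⁺`-sentences) whose open assumptions all belong
to `Γ ∪ Δ` and in which every open assumption occurring *unsafely* (i.e. in the right
main subproof of an application of `→`-Elim) belongs to `Γ`.  Assumptions may be
discharged only at safe occurrences, so discharge always happens in the `Δ` zone. -/
inductive Prf (L : Signature) :
    Set (Formula L.plus) → Set (Formula L.plus) → Formula L.plus → Prop
  | hyp {Γ Δ : Set (Formula L.plus)} {φ} : φ ∈ Γ ∪ Δ → φ.Sentence → Prf L Γ Δ φ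
  | weaken {Γ Γ' Δ Δ' φ} : Γ ⊆ Γ' → Δ ⊆ Δ' → Prf L Γ Δ φ → Prf L Γ' Δ' φ
  | topIntro {Γ Δ} : Prf L Γ Δ .top
  | botElim {Γ Δ φ} : φ.Sentence → Prf L Γ Δ .bot → Prf L Γ Δ φ
  | andIntro {Γ Δ φ ψ} : Prf L Γ Δ φ → Prf L Γ Δ ψ → Prf L Γ Δ (.and φ ψ)
  | andElimL {Γ Δ φ ψ} : Prf L Γ Δ (.and φ ψ) → Prf L Γ Δ φ
  | andElimR {Γ Δ φ ψ} : Prf L Γ Δ (.and φ ψ) → Prf L Γ Δ ψ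
  | orIntroL {Γ Δ φ ψ} : ψ.Sentence → Prf L Γ Δ φ → Prf L Γ Δ (.or φ ψ)
  | orIntroR {Γ Δ φ ψ} : φ.Sentence → Prf L Γ Δ ψ → Prf L Γ Δ (.or φ ψ)
  | orElim {Γ Δ φ ψ χ} : Prf L Γ Δ (.or φ ψ) → Prf L Γ (insert φ Δ) χ →
      Prf L Γ (insert ψ Δ) χ → Prf L Γ Δ χ
  | impIntro {Γ Δ φ ψ} : φ.Sentence → Prf L Γ (insert φ Δ) ψ → Prf L Γ Δ (.imp φ ψ)
  | impElim {Γ Δ φ ψ} : Prf L Γ Δ φ → Prf L Γ ∅ (.imp φ ψ) → Prf L Γ Δ ψ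
  | intTrans {Γ Δ φ ψ χ} : Prf L Γ Δ (.imp φ ψ) → Prf L Γ Δ (.imp ψ χ) →
      Prf L Γ Δ (.imp φ χ)
  | intAndIntro {Γ Δ φ ψ χ} : Prf L Γ Δ (.imp φ ψ) → Prf L Γ Δ (.imp φ χ) →
      Prf L Γ Δ (.imp φ (.and ψ χ))
  | intOrElim {Γ Δ φ ψ χ} : Prf L Γ Δ (.imp φ χ) → Prf L Γ Δ (.imp ψ χ) →
      Prf L Γ Δ (.imp (.or φ ψ) χ)
  | intAllIntro {Γ Δ φ ψ} : φ.Sentence → Prf L Γ Δ (.all (.imp φ ψ)) →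
      Prf L Γ Δ (.imp φ (.all ψ))
  | intExElim {Γ Δ φ ψ} : ψ.Sentence → Prf L Γ Δ (.all (.imp φ ψ)) →
      Prf L Γ Δ (.imp (.ex φ) ψ)
  | allIntro {Γ Δ Γ' Δ' φ} {i : ℕ} : Γ' ⊆ Γ → Δ' ⊆ Δ → FreshIn i Γ' → FreshIn i Δ' →
      ¬ φ.OccC (Sum.inr i) → Prf L Γ' Δ' (subst0 φ (aconst L i)) → Prf L Γ Δ (.all φ)
  | allElim {Γ Δ φ} {t : Term L.plus} : t.Closed → Prf L Γ Δ (.all φ) →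
      Prf L Γ Δ (subst0 φ t)
  | cd {Γ Δ φ ψ} : φ.Sentence → Prf L Γ Δ (.all (.or φ ψ)) → Prf L Γ Δ (.or φ (.all ψ))
  | exIntro {Γ Δ φ} {t : Term L.plus} : t.Closed → (Formula.ex φ).Sentence →
      Prf L Γ Δ (subst0 φ t) → Prf L Γ Δ (.ex φ)
  | exElim {Γ Δ Γ' Δ' φ ψ} {i : ℕ} : Γ' ⊆ Γ → Δ' ⊆ Δ → FreshIn i Γ' → FreshIn i Δ' →
      ¬ φ.OccC (Sum.inr i) → ¬ ψ.OccC (Sum.inr i) → Prf L Γ Δ (.ex φ) →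
      Prf L Γ' (insert (subst0 φ (aconst L i)) Δ') ψ → Prf L Γ Δ ψ

/-- `Γ ⊢ φ`: there is a proof of `φ` from `Γ` in `NBQL_CD^r`. -/
def Prv (L : Signature) (Γ : Set (Formula L.plus)) (φ : Formula L.plus) : Prop :=
  Prf L Γ ∅ φ

end BQL

namespace BQL

section

variable {L : Signature}

namespace Term

theorem ClosedAt.shiftUp {t : Term L} {k : ℕ} (h : t.ClosedAt k) : t.shiftUp.ClosedAt (k + 1) := by
  induction t with
  | var n => simpa [Term.shiftUp, ClosedAt] using h
  | const c => trivial
  | func f ts ih => exact fun i => ih i (h i)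

theorem closedAt_of_shiftUp {t : Term L} {k : ℕ} (h : t.shiftUp.ClosedAt (k + 1)) :
    t.ClosedAt k := by
  induction t with
  | var n => simpa [Term.shiftUp, ClosedAt] using h
  | const c => trivial
  | func f ts ih => exact fun i => ih i (h i)

theorem applySub_eq_self {σ : ℕ → Term L} {k : ℕ} (hσ : ∀ n < k, σ n = .var n) {t : Term L}
    (h : t.ClosedAt k) : t.applySub σ = t := by
  induction t with
  | var n => exact hσ n h
  | const c => rfl
  | func f ts ih => exact congrArg (func f) (funext fun i => ih i (h i))

theorem ClosedAt.applySub {σ : ℕ → Term L} {k m : ℕ} (hσ : ∀ n < k, (σ n).ClosedAt m)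
    {t : Term L} (h : t.ClosedAt k) : (t.applySub σ).ClosedAt m := by
  induction t with
  | var n => exact hσ n h
  | const c => trivial
  | func f ts ih => exact fun i => ih i (h i)

theorem closedAt_of_applySub {σ : ℕ → Term L} {k m : ℕ} (hσ : ∀ n, (σ n).ClosedAt m → n < k)
    {t : Term L} (h : (t.applySub σ).ClosedAt m) : t.ClosedAt k := by
  induction t with
  | var n => exact hσ n h
  | const c => trivial
  | func f ts ih => exact fun i => ih i (h i)

end Term

namespace Formula

theorem applySub_eq_self {φ : Formula L} {σ : ℕ → Term L} {k : ℕ} (hσ : ∀ n < k, σ n = .var n)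
    (h : φ.ClosedAt k) : φ.applySub σ = φ := by
  have lift : ∀ {σ : ℕ → Term L} {k : ℕ}, (∀ n < k, σ n = .var n) →
      ∀ n < k + 1, liftSub σ n = .var n := by
    intro σ k hσ n hn
    cases n with
    | zero => rfl
    | succ n => simp [liftSub, hσ n (by omega), Term.shiftUp]
  induction φ generalizing σ k with
  | top => rfl
  | bot => rfl
  | rel R ts => exact congrArg (rel R) (funext fun i => Term.applySub_eq_self hσ (h i))
  | and φ ψ ih₁ ih₂ => exact congrArg₂ and (ih₁ hσ h.1) (ih₂ hσ h.2)
  | or φ ψ ih₁ ih₂ => exact congrArg₂ or (ih₁ hσ h.1) (ih₂ hσ h.2)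
  | imp φ ψ ih₁ ih₂ => exact congrArg₂ imp (ih₁ hσ h.1) (ih₂ hσ h.2)
  | all φ ih => exact congrArg all (ih (lift hσ) h)
  | ex φ ih => exact congrArg ex (ih (lift hσ) h)

theorem ClosedAt.applySub {φ : Formula L} {σ : ℕ → Term L} {k m : ℕ}
    (hσ : ∀ n < k, (σ n).ClosedAt m) (h : φ.ClosedAt k) : (φ.applySub σ).ClosedAt m := by
  have lift : ∀ {σ : ℕ → Term L} {k m : ℕ}, (∀ n < k, (σ n).ClosedAt m) →
      ∀ n < k + 1, (liftSub σ n).ClosedAt (m + 1) := by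
    intro σ k m hσ n hn
    cases n with
    | zero => exact Nat.succ_pos m
    | succ n => exact (hσ n (by omega)).shiftUp
  induction φ generalizing σ k m with
  | top => trivial
  | bot => trivial
  | rel R ts => exact fun i => Term.ClosedAt.applySub hσ (h i)
  | and φ ψ ih₁ ih₂ => exact ⟨ih₁ hσ h.1, ih₂ hσ h.2⟩
  | or φ ψ ih₁ ih₂ => exact ⟨ih₁ hσ h.1, ih₂ hσ h.2⟩
  | imp φ ψ ih₁ ih₂ => exact ⟨ih₁ hσ h.1, ih₂ hσ h.2⟩
  | all φ ih => exact ih (lift hσ) h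
  | ex φ ih => exact ih (lift hσ) h

theorem closedAt_of_applySub {φ : Formula L} {σ : ℕ → Term L} {k m : ℕ}
    (hσ : ∀ n, (σ n).ClosedAt m → n < k) (h : (φ.applySub σ).ClosedAt m) : φ.ClosedAt k := by
  have lift : ∀ {σ : ℕ → Term L} {k m : ℕ}, (∀ n, (σ n).ClosedAt m → n < k) →
      ∀ n, (liftSub σ n).ClosedAt (m + 1) → n < k + 1 := by
    intro σ k m hσ n hn
    cases n with
    | zero => omega
    | succ n => exact Nat.succ_lt_succ (hσ n (Term.closedAt_of_shiftUp hn))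
  induction φ generalizing σ k m with
  | top => trivial
  | bot => trivial
  | rel R ts => exact fun i => Term.closedAt_of_applySub hσ (h i)
  | and φ ψ ih₁ ih₂ => exact ⟨ih₁ hσ h.1, ih₂ hσ h.2⟩
  | or φ ψ ih₁ ih₂ => exact ⟨ih₁ hσ h.1, ih₂ hσ h.2⟩
  | imp φ ψ ih₁ ih₂ => exact ⟨ih₁ hσ h.1, ih₂ hσ h.2⟩
  | all φ ih => exact ih (lift hσ) h
  | ex φ ih => exact ih (lift hσ) h

theorem Sentence.subst0_eq {φ : Formula L} (h : φ.Sentence) (t : Term L) : subst0 φ t = φ :=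
  applySub_eq_self (fun _ hn => absurd hn (Nat.not_lt_zero _)) h

theorem ClosedAt.subst0 {φ : Formula L} (h : φ.ClosedAt 1) {t : Term L} (ht : t.Closed) :
    (subst0 φ t).Sentence := by
  refine ClosedAt.applySub (fun n hn => ?_) h
  obtain rfl : n = 0 := by omega
  exact ht

theorem closedAt_of_subst0 {φ : Formula L} {t : Term L} (h : (BQL.subst0 φ t).Sentence) :
    φ.ClosedAt 1 := by
  refine closedAt_of_applySub (fun n hn => ?_) h
  cases n with
  | zero => exact Nat.one_pos
  | succ n => exact absurd hn (Nat.not_lt_zero n)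

end Formula

theorem subst0_boxN (n : ℕ) (φ : Formula L) (t : Term L) :
    subst0 (boxN n φ) t = boxN n (subst0 φ t) := by
  induction n with
  | zero => rfl
  | succ n ih => exact congrArg (Formula.imp .top) ih

theorem boxN_closedAt {n k : ℕ} {φ : Formula L} : (boxN n φ).ClosedAt k ↔ φ.ClosedAt k := by
  induction n with
  | zero => rfl
  | succ n ih => exact ⟨fun h => ih.1 h.2, fun h => ⟨trivial, ih.2 h⟩⟩

theorem boxN_occC {n : ℕ} {c : L.Const} {φ : Formula L} : (boxN n φ).OccC c ↔ φ.OccC c := by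
  induction n with
  | zero => rfl
  | succ n ih => simp [boxN, Formula.OccC, ih]

theorem boxN_box (n : ℕ) (φ : Formula L) : boxN n (.imp .top φ) = boxN (n + 1) φ := by
  induction n with
  | zero => rfl
  | succ n ih => exact congrArg (Formula.imp .top) ih

variable {Γ Δ G S : Set (Formula L.plus)} {A B C D X Y Z : Formula L.plus}

theorem Prf.sentence (h : Prf L Γ Δ A) : A.Sentence := by
  induction h with
  | hyp _ h => exact h
  | weaken _ _ _ ih => exact ih
  | topIntro => trivial
  | botElim h _ _ => exact h
  | andIntro _ _ ih₁ ih₂ => exact ⟨ih₁, ih₂⟩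
  | andElimL _ ih => exact ih.1
  | andElimR _ ih => exact ih.2
  | orIntroL h _ ih => exact ⟨ih, h⟩
  | orIntroR h _ ih => exact ⟨h, ih⟩
  | orElim _ _ _ _ ih _ => exact ih
  | impIntro h _ ih => exact ⟨h, ih⟩
  | impElim _ _ _ ih => exact ih.2
  | intTrans _ _ ih₁ ih₂ => exact ⟨ih₁.1, ih₂.2⟩
  | intAndIntro _ _ ih₁ ih₂ => exact ⟨ih₁.1, ih₁.2, ih₂.2⟩
  | intOrElim _ _ ih₁ ih₂ => exact ⟨⟨ih₁.1, ih₂.1⟩, ih₁.2⟩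
  | intAllIntro h _ ih => exact ⟨h, ih.2⟩
  | intExElim h _ ih => exact ⟨ih.1, h⟩
  | allIntro _ _ _ _ _ _ ih => exact Formula.closedAt_of_subst0 ih
  | allElim ht _ ih => exact Formula.ClosedAt.subst0 ih ht
  | cd h _ ih => exact ⟨h, ih.2⟩
  | exIntro _ h _ _ => exact h
  | exElim _ _ _ _ _ _ _ _ _ ih => exact ih

/-- Provability without assumptions. -/
def Thm (A : Formula L.plus) : Prop := Prf L ∅ ∅ A

namespace Thm

theorem prf (h : Thm A) : Prf L Γ Δ A := .weaken (Set.empty_subset _) (Set.empty_subset _) h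

theorem mp (h : Thm (.imp A B)) (hA : Prf L Γ Δ A) : Prf L Γ Δ B := .impElim hA h.prf

theorem of_prf (hA : A.Sentence) (h : Prf L ∅ {A} B) : Thm (.imp A B) :=
  .impIntro hA (by simpa using h)

theorem trans (h₁ : Thm (.imp A B)) (h₂ : Thm (.imp B C)) : Thm (.imp A C) := .intTrans h₁ h₂

end Thm

theorem Prf.self (hA : A.Sentence) : Prf L Γ {A} A := .hyp (.inr rfl) hA

theorem thm_imp_const (hA : A.Sentence) (hB : B.Sentence) : Thm (.imp A (.imp B A)) :=
  .of_prf hA (.impIntro hB (.hyp (by simp) hA))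

theorem thm_and_left (hA : A.Sentence) (hB : B.Sentence) : Thm (.imp (.and A B) A) :=
  .of_prf ⟨hA, hB⟩ (.andElimL (.self ⟨hA, hB⟩))

theorem thm_and_right (hA : A.Sentence) (hB : B.Sentence) : Thm (.imp (.and A B) B) :=
  .of_prf ⟨hA, hB⟩ (.andElimR (.self ⟨hA, hB⟩))

theorem thm_boxN_mono (h : Thm (.imp A B)) (n : ℕ) : Thm (.imp (boxN n A) (boxN n B)) := by
  induction n with
  | zero => exact h
  | succ n ih =>
    have hs : (boxN (n + 1) A).Sentence := boxN_closedAt.2 h.sentence.1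
    exact .of_prf hs (.intTrans (.self hs) ih.prf)

theorem thm_boxN_le (hA : A.Sentence) {n m : ℕ} (h : n ≤ m) :
    Thm (.imp (boxN n A) (boxN m A)) := by
  induction m, h using Nat.le_induction with
  | base => exact .of_prf (boxN_closedAt.2 hA) (.self (boxN_closedAt.2 hA))
  | succ m _ ih => exact ih.trans (thm_imp_const (boxN_closedAt.2 hA) trivial)

theorem thm_boxN_and (hA : A.Sentence) (hB : B.Sentence) (n : ℕ) :
    Thm (.imp (.and (boxN n A) (boxN n B)) (boxN n (.and A B))) := by
  induction n with
  | zero => exact .of_prf ⟨hA, hB⟩ (.self ⟨hA, hB⟩)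
  | succ n ih =>
    have hs : (Formula.and (boxN (n + 1) A) (boxN (n + 1) B)).Sentence :=
      ⟨boxN_closedAt.2 hA, boxN_closedAt.2 hB⟩
    exact .of_prf hs (.intTrans (.intAndIntro (.andElimL (.self hs)) (.andElimR (.self hs))) ih.prf)

theorem thm_all_boxN (hA : A.ClosedAt 1) (n : ℕ) :
    Thm (.imp (.all (boxN n A)) (boxN n (.all A))) := by
  induction n with
  | zero => exact .of_prf hA (.self hA)
  | succ n ih =>
    have hs : (Formula.all (boxN (n + 1) A)).Sentence :=
      (boxN_closedAt (n := n + 1)).2 hA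
    exact .of_prf hs (.intTrans (.intAllIntro trivial (.self hs)) ih.prf)

/-- `ConjOf S C`: `C` is a finite conjunction of sentences from `S`. -/
inductive ConjOf (S : Set (Formula L.plus)) : Formula L.plus → Prop
  | top : ConjOf S .top
  | mem {φ} : φ ∈ S → φ.Sentence → ConjOf S φ
  | and {φ ψ} : ConjOf S φ → ConjOf S ψ → ConjOf S (.and φ ψ)

namespace ConjOf

theorem sentence (h : ConjOf S C) : C.Sentence := by
  induction h with
  | top => trivial
  | mem _ h => exact h
  | and _ _ ih₁ ih₂ => exact ⟨ih₁, ih₂⟩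

theorem mono (hS : S ⊆ G) (h : ConjOf S C) : ConjOf G C := by
  induction h with
  | top => exact .top
  | mem h hs => exact .mem (hS h) hs
  | and _ _ ih₁ ih₂ => exact .and ih₁ ih₂

theorem not_occC {i : ℕ} (hS : FreshIn i S) (h : ConjOf S C) : ¬ C.OccC (Sum.inr i) := by
  induction h with
  | top => exact id
  | mem h _ => exact hS _ h
  | and _ _ ih₁ ih₂ => exact not_or.2 ⟨ih₁, ih₂⟩

theorem prf (hS : S ⊆ Γ ∪ Δ) (h : ConjOf S C) : Prf L Γ Δ C := by
  induction h with
  | top => exact .topIntro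
  | mem h hs => exact .hyp (hS h) hs
  | and _ _ ih₁ ih₂ => exact .andIntro ih₁ ih₂

theorem of_insert (hA : A.Sentence) (h : ConjOf (insert A S) C) :
    ∃ D, ConjOf S D ∧ Thm (.imp (.and D A) C) := by
  induction h with
  | top => exact ⟨.top, .top, .of_prf ⟨trivial, hA⟩ .topIntro⟩
  | mem h hs =>
    rcases h with rfl | h
    · exact ⟨.top, .top, thm_and_right trivial hA⟩
    · exact ⟨_, .mem h hs, thm_and_left hs hA⟩
  | and _ _ ih₁ ih₂ =>
    obtain ⟨D₁, h₁, t₁⟩ := ih₁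
    obtain ⟨D₂, h₂, t₂⟩ := ih₂
    have hs : (Formula.and (.and D₁ D₂) A).Sentence := ⟨⟨h₁.sentence, h₂.sentence⟩, hA⟩
    have hp : Prf L ∅ {Formula.and (.and D₁ D₂) A} _ := .self hs
    exact ⟨_, .and h₁ h₂, .of_prf hs (.andIntro
      (t₁.mp (.andIntro hp.andElimL.andElimL hp.andElimR))
      (t₂.mp (.andIntro hp.andElimL.andElimR hp.andElimR)))⟩

end ConjOf

/-- Some iterated box of `X` is provably implied by a finite conjunction of members of `G`. -/
def BoxDerivable (G : Set (Formula L.plus)) (X : Formula L.plus) : Prop :=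
  ∃ C n, ConjOf G C ∧ Thm (.imp C (boxN n X))

namespace BoxDerivable

theorem sentence (h : BoxDerivable G X) : X.Sentence := by
  obtain ⟨C, n, -, h⟩ := h
  exact boxN_closedAt.1 h.sentence.2

theorem of_thm (h : Thm X) : BoxDerivable G X :=
  ⟨.top, 0, .top, .of_prf trivial h.prf⟩

theorem mono (hG : S ⊆ G) (h : BoxDerivable S X) : BoxDerivable G X := by
  obtain ⟨C, n, hC, h⟩ := h
  exact ⟨C, n, hC.mono hG, h⟩

theorem map (h : BoxDerivable G X) (hXY : Thm (.imp X Y)) : BoxDerivable G Y := by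
  obtain ⟨C, n, hC, h⟩ := h
  exact ⟨C, n, hC, h.trans (thm_boxN_mono hXY n)⟩

theorem and (hX : BoxDerivable G X) (hY : BoxDerivable G Y) : BoxDerivable G (.and X Y) := by
  have sX := hX.sentence
  have sY := hY.sentence
  obtain ⟨C₁, n₁, hC₁, h₁⟩ := hX
  obtain ⟨C₂, n₂, hC₂, h₂⟩ := hY
  have s₁ := hC₁.sentence
  have s₂ := hC₂.sentence
  refine ⟨.and C₁ C₂, max n₁ n₂, hC₁.and hC₂, Thm.trans ?_ (thm_boxN_and sX sY _)⟩
  exact .intAndIntro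
    (((thm_and_left s₁ s₂).trans h₁).trans (thm_boxN_le sX (le_max_left _ _)))
    (((thm_and_right s₁ s₂).trans h₂).trans (thm_boxN_le sY (le_max_right _ _)))

theorem map_and (hX : BoxDerivable G X) (hY : BoxDerivable G Y)
    (h : Prf L ∅ {.and X Y} Z) : BoxDerivable G Z :=
  (hX.and hY).map (.of_prf ⟨hX.sentence, hY.sentence⟩ h)

theorem unbox (h : BoxDerivable G (.imp .top X)) : BoxDerivable G X := by
  obtain ⟨C, n, hC, h⟩ := h
  exact ⟨C, n + 1, hC, boxN_box n X ▸ h⟩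

theorem all {i : ℕ} (hG : FreshIn i G) (hX : ¬ X.OccC (Sum.inr i))
    (h : BoxDerivable G (subst0 X (aconst L i))) : BoxDerivable G (.all X) := by
  have sX := Formula.closedAt_of_subst0 h.sentence
  obtain ⟨C, n, hC, h⟩ := h
  refine ⟨C, n, hC, Thm.trans (.intAllIntro hC.sentence ?_) (thm_all_boxN sX n)⟩
  refine .allIntro (i := i) subset_rfl subset_rfl (fun _ h => h.elim) (fun _ h => h.elim)
    (not_or.2 ⟨hC.not_occC hG, mt boxN_occC.1 hX⟩) ?_
  change Prf L ∅ ∅ (.imp (subst0 C _) (subst0 (boxN n X) _))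
  rwa [hC.sentence.subst0_eq, subst0_boxN]

end BoxDerivable

/-- A finite conjunction of members of `Δ` implies `X`, up to iterated boxes, modulo `G`. -/
def CondDerivable (G Δ : Set (Formula L.plus)) (X : Formula L.plus) : Prop :=
  ∃ D, ConjOf Δ D ∧ BoxDerivable G (.imp D X)

namespace CondDerivable

theorem sentence (h : CondDerivable G Δ X) : X.Sentence := by
  obtain ⟨D, -, h⟩ := h
  exact h.sentence.2

theorem map (h : CondDerivable G Δ X) (hXY : Prf L ∅ {X} Y) : CondDerivable G Δ Y := by
  have sX := h.sentence
  obtain ⟨D, hD, h⟩ := h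
  exact ⟨D, hD, h.map (.of_prf h.sentence
    (.intTrans (.self h.sentence) (Thm.of_prf sX hXY).prf))⟩

theorem and (hX : CondDerivable G Δ X) (hY : CondDerivable G Δ Y) :
    CondDerivable G Δ (.and X Y) := by
  obtain ⟨D, hD, hX⟩ := hX
  obtain ⟨E, hE, hY⟩ := hY
  have hs : (Formula.and (.imp D X) (.imp E Y)).Sentence := ⟨hX.sentence, hY.sentence⟩
  exact ⟨.and D E, hD.and hE, hX.map_and hY (.intAndIntro
    (.intTrans (thm_and_left hD.sentence hE.sentence).prf (.andElimL (.self hs)))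
    (.intTrans (thm_and_right hD.sentence hE.sentence).prf (.andElimR (.self hs))))⟩

theorem map_and (hX : CondDerivable G Δ X) (hY : CondDerivable G Δ Y)
    (h : Prf L ∅ {.and X Y} Z) : CondDerivable G Δ Z :=
  (hX.and hY).map h

theorem of_insert (hA : A.Sentence) (h : CondDerivable G (insert A Δ) X) :
    ∃ D, ConjOf Δ D ∧ BoxDerivable G (.imp (.and D A) X) := by
  obtain ⟨C, hC, h⟩ := h
  obtain ⟨D, hD, t⟩ := hC.of_insert hA
  exact ⟨D, hD, h.map (.of_prf h.sentence (.intTrans t.prf (.self h.sentence)))⟩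

theorem of_empty (h : CondDerivable G ∅ X) : BoxDerivable G X := by
  obtain ⟨D, hD, h⟩ := h
  exact (h.map (.of_prf h.sentence (.intTrans
    (Thm.of_prf (A := .top) trivial (hD.prf (Set.empty_subset _))).prf (.self h.sentence)))).unbox

theorem impIntro (hA : A.Sentence) (h : CondDerivable G (insert A Δ) B) :
    CondDerivable G Δ (.imp A B) := by
  obtain ⟨D, hD, h⟩ := h.of_insert hA
  refine ⟨D, hD, h.map (.of_prf h.sentence (.impIntro hD.sentence (.intTrans
    (.impIntro hA (.andIntro (.hyp ?_ hD.sentence) (.hyp ?_ hA))) (.hyp ?_ h.sentence))))⟩ <;> simp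

theorem impElim (hA : CondDerivable G Δ A) (h : CondDerivable G ∅ (.imp A B)) :
    CondDerivable G Δ B := by
  obtain ⟨D, hD, hA⟩ := hA
  have h := h.of_empty
  have hs : (Formula.and (.imp D A) (.imp A B)).Sentence := ⟨hA.sentence, h.sentence⟩
  exact ⟨D, hD, hA.map_and h (.intTrans (.andElimL (.self hs)) (.andElimR (.self hs)))⟩

theorem thm_and_or (hC : C.Sentence) (hA : A.Sentence) (hB : B.Sentence) :
    Thm (.imp (.and C (.or A B)) (.or (.and C A) (.and C B))) := by
  have hs : (Formula.and C (.or A B)).Sentence := ⟨hC, hA, hB⟩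
  refine .of_prf hs (.orElim (φ := A) (ψ := B) (.andElimR (.self hs)) ?_ ?_)
  · exact .orIntroL ⟨hC, hB⟩ (.andIntro (.andElimL (.hyp (by simp) hs)) (.hyp (by simp) hA))
  · exact .orIntroR ⟨hC, hA⟩ (.andIntro (.andElimL (.hyp (by simp) hs)) (.hyp (by simp) hB))

theorem orElim (h : CondDerivable G Δ (.or A B)) (hA : CondDerivable G (insert A Δ) X)
    (hB : CondDerivable G (insert B Δ) X) : CondDerivable G Δ X := by
  have sA := h.sentence.1
  have sB := h.sentence.2
  obtain ⟨D, hD, h⟩ := h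
  obtain ⟨E, hE, hA⟩ := hA.of_insert sA
  obtain ⟨F, hF, hB⟩ := hB.of_insert sB
  have sE := hE.sentence
  have sF := hF.sentence
  have hDEF := (hD.and hE).and hF
  have sC := hDEF.sentence
  refine ⟨_, hDEF, (h.and hA).map_and hB ?_⟩
  have hs := Prf.self (Γ := ∅) (show Formula.Sentence
    (.and (.and (.imp D (.or A B)) (.imp (.and E A) X)) (.imp (.and F B) X)) from
    ⟨⟨h.sentence, hA.sentence⟩, hB.sentence⟩)
  have hc : Prf L ∅ ∅ (.imp (.and (.and D E) F) (.and (.and D E) F)) := Thm.of_prf sC (.self sC)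
  have hD' : Thm (.imp (.and (.and D E) F) D) := .of_prf sC (.andElimL (.andElimL (.self sC)))
  have hA' : Thm (.imp (.and (.and (.and D E) F) A) (.and E A)) :=
    .of_prf ⟨sC, sA⟩ (.andIntro (.andElimR (.andElimL (.andElimL (.self ⟨sC, sA⟩))))
      (.andElimR (.self ⟨sC, sA⟩)))
  have hB' : Thm (.imp (.and (.and (.and D E) F) B) (.and F B)) :=
    .of_prf ⟨sC, sB⟩ (.andIntro (.andElimR (.andElimL (.self ⟨sC, sB⟩)))
      (.andElimR (.self ⟨sC, sB⟩)))
  exact .intTrans (.intAndIntro (Thm.prf hc) (.intTrans hD'.prf hs.andElimL.andElimL))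
    (.intTrans (thm_and_or sC sA sB).prf
      (.intOrElim (.intTrans hA'.prf hs.andElimL.andElimR) (.intTrans hB'.prf hs.andElimR)))

theorem mono (hG : S ⊆ G) (hΔ : Γ ⊆ Δ) (h : CondDerivable S Γ X) : CondDerivable G Δ X := by
  obtain ⟨D, hD, h⟩ := h
  exact ⟨D, hD.mono hΔ, h.mono hG⟩

theorem allIntro {i : ℕ} (hG : FreshIn i G) (hΔ : FreshIn i Δ) (hX : ¬ X.OccC (Sum.inr i))
    (h : CondDerivable G Δ (subst0 X (aconst L i))) : CondDerivable G Δ (.all X) := by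
  obtain ⟨D, hD, h⟩ := h
  have h' : BoxDerivable G (.all (.imp D X)) := by
    refine .all hG (not_or.2 ⟨hD.not_occC hΔ, hX⟩) ?_
    change BoxDerivable G (.imp (subst0 D _) (subst0 X _))
    rwa [hD.sentence.subst0_eq]
  exact ⟨D, hD, h'.map (.of_prf h'.sentence (.intAllIntro hD.sentence (.self h'.sentence)))⟩

theorem exElim {i : ℕ} (hG : FreshIn i S) (hΔ : FreshIn i Γ) (hSG : S ⊆ G) (hΓΔ : Γ ⊆ Δ)
    (hA : ¬ A.OccC (Sum.inr i)) (hB : ¬ B.OccC (Sum.inr i))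
    (hex : CondDerivable G Δ (.ex A))
    (h : CondDerivable S (insert (subst0 A (aconst L i)) Γ) B) : CondDerivable G Δ B := by
  have sA : A.ClosedAt 1 := hex.sentence
  have sB := h.sentence
  obtain ⟨E, hE, hex⟩ := hex
  obtain ⟨D, hD, h⟩ := h.of_insert (sA.subst0 (t := aconst L i) trivial)
  have sD := hD.sentence
  have sE := hE.sentence
  have hDi := hD.not_occC hΔ
  have sDA : (Formula.ex (.and D A)).Sentence :=
    Formula.closedAt_of_subst0 (φ := .and D A) (t := aconst L i)
      ⟨show (subst0 D (aconst L i)).Sentence by rwa [sD.subst0_eq], sA.subst0 trivial⟩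
  have h' : BoxDerivable S (.all (.imp (.and D A) B)) := by
    refine .all hG (not_or.2 ⟨not_or.2 ⟨hDi, hA⟩, hB⟩) ?_
    change BoxDerivable S (.imp (.and (subst0 D _) (subst0 A _)) (subst0 B _))
    rwa [sD.subst0_eq, sB.subst0_eq]
  have hdist : Thm (.imp (.and D (.ex A)) (.ex (.and D A))) := by
    have hs : (Formula.and D (.ex A)).Sentence := ⟨sD, sA⟩
    refine .of_prf hs (.exElim (i := i) (φ := A) subset_rfl subset_rfl (fun _ h => h.elim) ?_ hA
      (not_or.2 ⟨hDi, hA⟩) (.andElimR (.self hs)) (.exIntro (t := aconst L i) trivial sDA ?_))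
    · rintro _ rfl
      exact not_or.2 ⟨hDi, hA⟩
    · change Prf L _ _ (.and (subst0 D _) (subst0 A _))
      rw [sD.subst0_eq]
      exact .andIntro (.andElimL (.hyp (by simp) hs)) (.hyp (by simp) (sA.subst0 trivial))
  have hs := Prf.self (Γ := ∅) (show Formula.Sentence
    (.and (.imp E (.ex A)) (.all (.imp (.and D A) B))) from ⟨hex.sentence, h'.sentence⟩)
  exact ⟨_, (hD.mono hΓΔ).and hE, hex.map_and (h'.mono hSG)
    (.intTrans (.intAndIntro (thm_and_left sD sE).prf
      (.intTrans (thm_and_right sD sE).prf hs.andElimL))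
      (.intTrans hdist.prf (.intExElim sB hs.andElimR)))⟩

end CondDerivable

/-- Every derivation can be turned into one making only safe use of its assumptions, at the cost
of boxing. -/
theorem Prf.condDerivable (h : Prf L Γ Δ A) : CondDerivable Γ Δ A := by
  induction h with
  | hyp h hs =>
    rcases h with h | h
    · exact ⟨.top, .top, _, 0, .mem h hs, thm_imp_const hs trivial⟩
    · exact ⟨_, .mem h hs, .of_thm (.of_prf hs (.self hs))⟩
  | weaken hΓ hΔ _ ih => exact ih.mono hΓ hΔ
  | topIntro => exact ⟨.top, .top, .of_thm (.of_prf trivial .topIntro)⟩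
  | botElim hs _ ih => exact ih.map (.botElim hs (.self ih.sentence))
  | andIntro _ _ ih₁ ih₂ => exact ih₁.and ih₂
  | andElimL _ ih => exact ih.map (.andElimL (.self ih.sentence))
  | andElimR _ ih => exact ih.map (.andElimR (.self ih.sentence))
  | orIntroL hs _ ih => exact ih.map (.orIntroL hs (.self ih.sentence))
  | orIntroR hs _ ih => exact ih.map (.orIntroR hs (.self ih.sentence))
  | orElim _ _ _ ih ih₁ ih₂ => exact ih.orElim ih₁ ih₂
  | impIntro hs _ ih => exact ih.impIntro hs
  | impElim _ _ ih₁ ih₂ => exact ih₁.impElim ih₂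
  | intTrans _ _ ih₁ ih₂ =>
    have hs := Prf.self (Γ := ∅) (ih₁.and ih₂).sentence
    exact ih₁.map_and ih₂ (.intTrans hs.andElimL hs.andElimR)
  | intAndIntro _ _ ih₁ ih₂ =>
    have hs := Prf.self (Γ := ∅) (ih₁.and ih₂).sentence
    exact ih₁.map_and ih₂ (.intAndIntro hs.andElimL hs.andElimR)
  | intOrElim _ _ ih₁ ih₂ =>
    have hs := Prf.self (Γ := ∅) (ih₁.and ih₂).sentence
    exact ih₁.map_and ih₂ (.intOrElim hs.andElimL hs.andElimR)
  | intAllIntro hs _ ih => exact ih.map (.intAllIntro hs (.self ih.sentence))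
  | intExElim hs _ ih => exact ih.map (.intExElim hs (.self ih.sentence))
  | allIntro hΓ hΔ fΓ fΔ hφ _ ih => exact (ih.allIntro fΓ fΔ hφ).mono hΓ hΔ
  | allElim ht _ ih => exact ih.map (.allElim ht (.self ih.sentence))
  | cd hs _ ih => exact ih.map (.cd hs (.self ih.sentence))
  | exIntro ht hs _ ih => exact ih.map (.exIntro ht hs (.self ih.sentence))
  | exElim hΓ hΔ fΓ fΔ hφ hψ _ _ ih₁ ih₂ => exact ih₁.exElim fΓ fΔ hΓ hΔ hφ hψ ih₂

theorem Prf.of_boxN {n : ℕ} (h : Prf L Γ ∅ (boxN n A)) : Prf L Γ ∅ A := by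
  induction n with
  | zero => exact h
  | succ n ih => exact ih (.impElim .topIntro h)

end

/-- **Unrestricted ∃-Elim** (Theorem 6): if `Γ ⊢ ∃v φ` and `Δ, φ(aᵢ) ⊢ ψ`, where the
fresh constant `aᵢ` does not occur in `Δ ∪ {φ, ψ}`, then `Γ ∪ Δ ⊢ ψ`. -/
theorem unrestricted_ex_elim {L : Signature} (Γ Δ : Set (Formula L.plus))
    (φ ψ : Formula L.plus) (i : ℕ)
    (hΓ : ∀ α ∈ Γ, Formula.Sentence α) (hΔ : ∀ α ∈ Δ, Formula.Sentence α)
    (hφ : φ.ClosedAt 1) (hψ : ψ.Sentence)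
    (hiΔ : FreshIn i Δ) (hiφ : ¬ φ.OccC (Sum.inr i)) (hiψ : ¬ ψ.OccC (Sum.inr i))
    (h1 : Prv L Γ (.ex φ)) (h2 : Prv L (insert (subst0 φ (aconst L i)) Δ) ψ) :
    Prv L (Γ ∪ Δ) ψ := by
  obtain ⟨C, n, hC, h⟩ := Prf.condDerivable h2 |>.of_empty
  refine Prf.of_boxN (n := n) ?_
  refine .exElim (Γ' := Δ) (Δ' := ∅) (i := i) Set.subset_union_right subset_rfl hiΔ
    (fun _ h => h.elim) hiφ (mt boxN_occC.1 hiψ)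
    (.weaken Set.subset_union_left subset_rfl h1) (h.mp (hC.prf ?_))
  simp

end BQL
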